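/- Let h > 0 and let (s,v,u,w) be a solution of the regularized blown-up system satisfying the energy relation with 0 < s(tau) < 1 for all tau, and suppose v(tau*) >= 0 for some tau* (no forward triple collision). If u(tau) converges as tau -> +infinity to a limit u_plus with cos(u_plus) nonzero (the limiting shape is not a binary collision shape), then v(tau) -> sqrt(2*h) and w(tau) -> 0 as tau -> +infinity; such a solution is called forward-hyperbolic. -/

import Mathlib

open Real Filter Topology MeasureTheory

/-- The regularized shape potential `W(u)` of the isosceles three-body problem with
masses `m1 = m2 = 1`, `m3`, where `mu = 2*m3/(2+m3)`. -/
noncomputable def Wpot (m3 u : ℝ) : ℝ :=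
  1 / Real.sqrt 2 +
    2 * m3 * Real.cos u ^ 2 /
      Real.sqrt (Real.cos u ^ 4 / 2 + (1 - Real.cos u ^ 4) / (2 * m3 / (2 + m3)))

/-- The energy function `E(s,v,u,w)` for energy `h`. -/
noncomputable def energyFn (m3 h s v u w : ℝ) : ℝ :=
  1 / 2 * (v ^ 2 * Real.cos u ^ 2 + w ^ 2) - (1 - s) * Wpot m3 u - h * s * Real.cos u ^ 2

/-- `(s,v,u,w) : ℝ → ℝ` is a (globally defined) solution of the regularized blown-up
system of the isosceles three-body problem with mass `m3` and energy `h`. -/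
def IsSolution (m3 h : ℝ) (s v u w : ℝ → ℝ) : Prop :=
  (∀ τ : ℝ, HasDerivAt s (v τ * s τ * (1 - s τ) * Real.cos (u τ) ^ 2) τ) ∧
  (∀ τ : ℝ, HasDerivAt v (1 / 2 * (1 - s τ) * v τ ^ 2 * Real.cos (u τ) ^ 2 + w τ ^ 2
      - (1 - s τ) * Wpot m3 (u τ)) τ) ∧
  (∀ τ : ℝ, HasDerivAt u (1 / 2 * Real.sqrt (1 + Real.cos (u τ) ^ 2) * w τ) τ) ∧
  (∀ τ : ℝ, HasDerivAt w (-(1 / 2) * (1 + s τ) * v τ * w τ * Real.cos (u τ) ^ 2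
      + 1 / 2 * Real.sqrt (1 + Real.cos (u τ) ^ 2) * (1 - s τ) * deriv (Wpot m3) (u τ)
      + 1 / 2 * (v τ ^ 2 - 2 * h * s τ) * Real.sqrt (1 + Real.cos (u τ) ^ 2)
          * Real.sin (u τ) * Real.cos (u τ)) τ)

/-- The solution satisfies the energy relation `E = 0` at all times. -/
def SatisfiesEnergy (m3 h : ℝ) (s v u w : ℝ → ℝ) : Prop :=
  ∀ τ : ℝ, energyFn m3 h (s τ) (v τ) (u τ) (w τ) = 0

/-- A function whose derivative is at most `-k` times its value wherever it is positive is bounded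
above by a function that tends to zero. -/
theorem exists_tendsto_zero_bound_of_deriv_le {f f' : ℝ → ℝ} {k T : ℝ} (hk : 0 < k)
    (hf : ∀ t, HasDerivAt f (f' t) t) (hf' : ∀ t, T ≤ t → 0 < f t → f' t ≤ -k * f t) :
    ∃ B : ℝ → ℝ, Tendsto B atTop (𝓝 0) ∧ ∀ t, T ≤ t → f t ≤ B t := by
  set K : ℝ := |f T| + 1
  have hK : 0 < K := by positivity
  have hB : ∀ t, HasDerivAt (fun t => K * exp (-(k / 2) * (t - T)))
      (-(k / 2) * (K * exp (-(k / 2) * (t - T)))) t := by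
    intro t
    have h₁ : HasDerivAt (fun t => -(k / 2) * (t - T)) (-(k / 2) * 1) t :=
      ((hasDerivAt_id t).sub_const T).const_mul _
    exact (h₁.exp.const_mul K).congr_deriv (by ring)
  refine ⟨fun t => K * exp (-(k / 2) * (t - T)), ?_, ?_⟩
  · have h₁ : Tendsto (fun t : ℝ => -(k / 2) * (t - T)) atTop atBot :=
      (tendsto_atTop_add_const_right atTop (-T) tendsto_id).const_mul_atTop_of_neg
        (by linarith : -(k / 2) < 0)
    simpa using (tendsto_exp_atBot.comp h₁).const_mul K
  · intro t ht
    refine image_le_of_deriv_right_lt_deriv_boundary (a := T) (b := t)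
      (fun x _ => (hf x).continuousAt.continuousWithinAt)
      (fun x _ => (hf x).hasDerivWithinAt) ?_ hB ?_ ⟨ht, le_rfl⟩
    · have := le_abs_self (f T)
      simp [K]
      linarith
    · intro x hx hfx
      have hpos : 0 < K * exp (-(k / 2) * (x - T)) := by positivity
      have := hf' x hx.1 (hfx ▸ hpos)
      rw [hfx] at this
      nlinarith

theorem Wpot_radicand_pos {m3 : ℝ} (hm3 : 0 < m3) (u : ℝ) :
    0 < cos u ^ 4 / 2 + (1 - cos u ^ 4) / (2 * m3 / (2 + m3)) := by
  have hc : cos u ^ 4 ≤ 1 := by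
    have := cos_sq_le_one u
    nlinarith [sq_nonneg (cos u)]
  rcases hc.lt_or_eq with hc | hc
  · have : 0 < (1 - cos u ^ 4) / (2 * m3 / (2 + m3)) := div_pos (by linarith) (by positivity)
    positivity
  · simp [hc]

theorem Wpot_pos {m3 : ℝ} (hm3 : 0 < m3) (u : ℝ) : 0 < Wpot m3 u := by
  unfold Wpot
  positivity

theorem continuous_Wpot {m3 : ℝ} (hm3 : 0 < m3) : Continuous (Wpot m3) := by
  unfold Wpot
  refine continuous_const.add (Continuous.div (by fun_prop) (by fun_prop) fun u => ?_)
  exact (sqrt_pos.2 (Wpot_radicand_pos hm3 u)).ne'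

section Solution

variable {m3 h : ℝ} {s v u w : ℝ → ℝ}

/-- The energy relation eliminates the shape potential from the equation for `v`. -/
theorem hasDerivAt_v_of_energy (hsol : IsSolution m3 h s v u w)
    (hE : SatisfiesEnergy m3 h s v u w) (t : ℝ) :
    HasDerivAt v (1 / 2 * w t ^ 2 + 1 / 2 * s t * cos (u t) ^ 2 * (2 * h - v t ^ 2)) t := by
  refine (hsol.2.1 t).congr_deriv ?_
  have := hE t
  unfold energyFn at this
  linarith

/-- Once `v` is nonnegative it stays nonnegative. -/
theorem v_nonneg_of_le (hm3 : 0 < m3) (hh : 0 < h) (hsol : IsSolution m3 h s v u w)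
    (hE : SatisfiesEnergy m3 h s v u w) (hs : ∀ t, 0 < s t ∧ s t < 1)
    {t₀ t : ℝ} (h₀ : 0 ≤ v t₀) (ht : t₀ ≤ t) : 0 ≤ v t := by
  have hder := hasDerivAt_v_of_energy hsol hE
  have key : -v t ≤ 0 := by
    refine image_le_of_deriv_right_lt_deriv_boundary (f := fun x => -v x) (B := fun _ => 0)
      (B' := fun _ => 0) (a := t₀) (b := t)
      (fun x _ => (hder x).continuousAt.neg.continuousWithinAt)
      (fun x _ => (hder x).neg.hasDerivWithinAt) (by simpa using h₀)
      (fun x => hasDerivAt_const x 0) (fun x _ hx => ?_) ⟨ht, le_rfl⟩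
    have hvx : v x = 0 := neg_eq_zero.1 hx
    have hEx := hE x
    unfold energyFn at hEx
    have h₁ : 0 < (1 - s x) * Wpot m3 (u x) :=
      mul_pos (sub_pos.2 (hs x).2) (Wpot_pos hm3 _)
    have h₂ : 0 ≤ h * s x * cos (u x) ^ 2 :=
      mul_nonneg (mul_pos hh (hs x).1).le (sq_nonneg _)
    rw [hvx] at hEx ⊢
    nlinarith
  linarith

/-- The size variable `s` is nondecreasing once `v` is nonnegative. -/
theorem s_monotoneOn (hm3 : 0 < m3) (hh : 0 < h) (hsol : IsSolution m3 h s v u w)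
    (hE : SatisfiesEnergy m3 h s v u w) (hs : ∀ t, 0 < s t ∧ s t < 1)
    {t₀ : ℝ} (h₀ : 0 ≤ v t₀) : MonotoneOn s (Set.Ici t₀) := by
  refine monotoneOn_of_deriv_nonneg (convex_Ici t₀)
    (fun x _ => (hsol.1 x).continuousAt.continuousWithinAt)
    (fun x _ => (hsol.1 x).differentiableAt.differentiableWithinAt) fun x hx => ?_
  rw [interior_Ici] at hx
  rw [(hsol.1 x).deriv]
  have hv := v_nonneg_of_le hm3 hh hsol hE hs h₀ (le_of_lt hx)
  exact mul_nonneg (mul_nonneg (mul_nonneg hv (hs x).1.le) (sub_pos.2 (hs x).2).le) (sq_nonneg _)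

/-- If the shape stays away from binary collision, `√(2h) - v` is bounded above by a function
tending to zero. -/
theorem exists_tendsto_zero_bound_sqrt_sub_v (hh : 0 < h) (hsol : IsSolution m3 h s v u w)
    (hE : SatisfiesEnergy m3 h s v u w) {T σ δ : ℝ} (hσ : 0 < σ) (hδ : 0 < δ)
    (hv : ∀ t, T ≤ t → 0 ≤ v t) (hsσ : ∀ t, T ≤ t → σ ≤ s t)
    (hc : ∀ t, T ≤ t → δ ≤ cos (u t) ^ 2) :
    ∃ B : ℝ → ℝ, Tendsto B atTop (𝓝 0) ∧ ∀ t, T ≤ t → √(2 * h) - v t ≤ B t := by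
  have hr : 0 < √(2 * h) := sqrt_pos.2 (by linarith)
  have hr2 : √(2 * h) ^ 2 = 2 * h := sq_sqrt (by linarith)
  refine exists_tendsto_zero_bound_of_deriv_le (k := 1 / 2 * (σ * δ) * √(2 * h)) (by positivity)
    (fun t => (hasDerivAt_v_of_energy hsol hE t).const_sub _) fun t ht hpos => ?_
  have h₁ : σ * δ ≤ s t * cos (u t) ^ 2 :=
    mul_le_mul (hsσ t ht) (hc t ht) hδ.le (hσ.le.trans (hsσ t ht))
  have h₂ : σ * δ * √(2 * h) ≤ s t * cos (u t) ^ 2 * (√(2 * h) + v t) :=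
    mul_le_mul h₁ (by linarith [hv t ht]) hr.le ((by positivity : 0 ≤ σ * δ).trans h₁)
  have h₃ := mul_le_mul_of_nonneg_right h₂ hpos.le
  have h₄ : s t * cos (u t) ^ 2 * (√(2 * h) + v t) * (√(2 * h) - v t)
      = s t * cos (u t) ^ 2 * (2 * h - v t ^ 2) := by
    linear_combination s t * cos (u t) ^ 2 * hr2
  linarith [sq_nonneg (w t)]

/-- If `v` and the shape are bounded away from zero and binary collision respectively, then
`s → 1`. -/
theorem tendsto_s_one (hsol : IsSolution m3 h s v u w) (hs : ∀ t, 0 < s t ∧ s t < 1)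
    {T σ δ r : ℝ} (hσ : 0 < σ) (hδ : 0 < δ) (hr : 0 < r) (hv : ∀ t, T ≤ t → r ≤ v t)
    (hsσ : ∀ t, T ≤ t → σ ≤ s t) (hc : ∀ t, T ≤ t → δ ≤ cos (u t) ^ 2) :
    Tendsto s atTop (𝓝 1) := by
  obtain ⟨B, hB, hsB⟩ := exists_tendsto_zero_bound_of_deriv_le (k := r * σ * δ) (T := T)
    (by positivity) (fun t => (hsol.1 t).const_sub 1) fun t ht hpos => by
      have h₁ : r * σ ≤ v t * s t :=
        mul_le_mul (hv t ht) (hsσ t ht) hσ.le (hr.le.trans (hv t ht))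
      have h₂ : r * σ * δ ≤ v t * s t * cos (u t) ^ 2 :=
        mul_le_mul h₁ (hc t ht) hδ.le ((by positivity : 0 ≤ r * σ).trans h₁)
      nlinarith [mul_le_mul_of_nonneg_right h₂ hpos.le]
  refine tendsto_of_tendsto_of_tendsto_of_le_of_le' (g := fun t => 1 - B t)
    (by simpa using hB.const_sub 1) tendsto_const_nhds ?_ (Eventually.of_forall fun t => (hs t).2.le)
  filter_upwards [eventually_ge_atTop T] with t ht
  linarith [hsB t ht]

end Solution

/-- if moreover `u(τ) → u₊` with `cos u₊ ≠ 0` (the limiting shape is not a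
binary collision shape), then `v(τ) → √(2h)` and `w(τ) → 0` as `τ → +∞`
(forward-hyperbolic solution). -/
theorem stmt13 (m3 h : ℝ) (hm3 : 0 < m3) (hh : 0 < h) (s v u w : ℝ → ℝ)
    (hsol : IsSolution m3 h s v u w) (hE : SatisfiesEnergy m3 h s v u w)
    (hs : ∀ τ : ℝ, 0 < s τ ∧ s τ < 1) (hv : ∃ τs : ℝ, 0 ≤ v τs)
    (uplus : ℝ) (hu : Tendsto u atTop (nhds uplus)) (hcos : Real.cos uplus ≠ 0) :
    Tendsto v atTop (nhds (Real.sqrt (2 * h))) ∧ Tendsto w atTop (nhds 0) := by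
  obtain ⟨τs, hvs⟩ := hv
  have hr : 0 < √(2 * h) := sqrt_pos.2 (by linarith)
  have hc2 : 0 < cos uplus ^ 2 := by positivity
  have hcu : Tendsto (fun t => cos (u t) ^ 2) atTop (𝓝 (cos uplus ^ 2)) :=
    ((continuous_cos.tendsto uplus).comp hu).pow 2
  have hcδ := hcu.eventually (eventually_ge_nhds (half_lt_self hc2))
  have hsσ : ∀ t, τs ≤ t → s τs ≤ s t := fun t ht =>
    s_monotoneOn hm3 hh hsol hE hs hvs Set.self_mem_Ici ht ht
  obtain ⟨T, hT⟩ := eventually_atTop.1 (hcδ.and (eventually_ge_atTop τs))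
  obtain ⟨B, hB, hvB⟩ := exists_tendsto_zero_bound_sqrt_sub_v hh hsol hE (hs τs).1 (half_pos hc2)
    (fun t ht => v_nonneg_of_le hm3 hh hsol hE hs hvs (hT t ht).2)
    (fun t ht => hsσ t (hT t ht).2) (fun t ht => (hT t ht).1)
  obtain ⟨T', hT'⟩ := eventually_atTop.1
    ((hB.eventually (eventually_le_nhds (half_pos hr))).and (eventually_ge_atTop T))
  have hs1 : Tendsto s atTop (𝓝 1) :=
    tendsto_s_one hsol hs (T := T') (hs τs).1 (half_pos hc2) (half_pos hr)
      (fun t ht => by linarith [hvB t (hT' t ht).2, (hT' t ht).1])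
      (fun t ht => hsσ t (hT t (hT' t ht).2).2) (fun t ht => (hT t (hT' t ht).2).1)
  set A : ℝ → ℝ := fun t => 2 * ((1 - s t) * Wpot m3 (u t) + h * s t * cos (u t) ^ 2) with hAdef
  have hEA : ∀ t, v t ^ 2 * cos (u t) ^ 2 + w t ^ 2 = A t := fun t => by
    have := hE t
    unfold energyFn at this
    simp only [hAdef]
    linarith
  have hA : Tendsto A atTop (𝓝 (2 * h * cos uplus ^ 2)) := by
    have hW := ((continuous_Wpot hm3).tendsto uplus).comp hu
    simpa [hAdef, mul_assoc] using
      (((hs1.const_sub 1).mul hW).add ((hs1.const_mul h).mul hcu)).const_mul 2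
  have hvlim : Tendsto v atTop (𝓝 √(2 * h)) := by
    have hup : Tendsto (fun t => √(A t / cos (u t) ^ 2)) atTop (𝓝 √(2 * h)) := by
      have := (hA.div hcu hc2.ne').sqrt
      rwa [mul_div_cancel_right₀ _ hc2.ne'] at this
    refine tendsto_of_tendsto_of_tendsto_of_le_of_le' (g := fun t => √(2 * h) - B t)
      (by simpa using hB.const_sub √(2 * h)) hup ?_ ?_
    · filter_upwards [eventually_ge_atTop T] with t ht
      linarith [hvB t ht]
    · filter_upwards [eventually_ge_atTop T] with t ht
      refine le_sqrt_of_sq_le ?_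
      rw [le_div_iff₀ ((half_pos hc2).trans_le (hT t ht).1), ← hEA t]
      linarith [sq_nonneg (w t)]
  refine ⟨hvlim, ?_⟩
  have hw2 : Tendsto (fun t => w t ^ 2) atTop (𝓝 0) := by
    have h₁ := hA.sub ((hvlim.pow 2).mul hcu)
    rw [sq_sqrt (by linarith), sub_self] at h₁
    exact h₁.congr fun t => by linarith [hEA t]
  have h₂ := hw2.sqrt
  simp only [sqrt_sq_eq_abs, sqrt_zero] at h₂
  exact tendsto_zero_iff_abs_tendsto_zero w |>.2 h₂
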